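/- arXiv:2311.11078 — 2 statements merged into one kernel-verified Lean document; each statement's English description precedes it below -/
import Mathlib

section
/- For all ℓ, m with 0 ≤ ℓ ≤ j-1 and 0 ≤ m ≤ p-1, one has ⁅e_ℓ, f'_m⁆ = 0. (The distinct-block case of identity (L:1) of Theorem 2.8 of the paper: root vectors built from distinct imaginary simple roots commute in this pairing.) -/
section IteratedBracket

variable {R L : Type*} [CommRing R] [LieRing L] [LieAlgebra R L]

theorem LieAlgebra.ad_pow_succ_apply (x y : L) (n : ℕ) :
    (LieAlgebra.ad R L x ^ (n + 1)) y = ⁅x, (LieAlgebra.ad R L x ^ n) y⁆ := by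
  rw [pow_succ', Module.End.mul_apply, LieAlgebra.ad_apply]

/-- If `x` and `y` are eigenvectors of `ad h`, then so is every `(ad x)ⁿ y`. -/
theorem LieAlgebra.exists_lie_ad_pow_eq_smul {h x y : L} {a b : R}
    (hx : ⁅h, x⁆ = a • x) (hy : ⁅h, y⁆ = b • y) (n : ℕ) :
    ∃ c : R, ⁅h, (LieAlgebra.ad R L x ^ n) y⁆ = c • (LieAlgebra.ad R L x ^ n) y := by
  induction n with
  | zero => exact ⟨b, by simpa using hy⟩
  | succ n ih =>
    obtain ⟨c, hc⟩ := ih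
    refine ⟨a + c, ?_⟩
    rw [ad_pow_succ_apply, leibniz_lie, hx, hc, smul_lie, lie_smul, add_smul]

/-- If `w` commutes with `x` and `y`, then it commutes with every `(ad x)ⁿ y`. -/
theorem LieAlgebra.lie_ad_pow_eq_zero {w x y : L} (hx : ⁅w, x⁆ = 0) (hy : ⁅w, y⁆ = 0) (n : ℕ) :
    ⁅w, (LieAlgebra.ad R L x ^ n) y⁆ = 0 := by
  induction n with
  | zero => simpa using hy
  | succ n ih => rw [ad_pow_succ_apply, leibniz_lie, hx, ih, zero_lie, lie_zero, add_zero]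

/-- The raising operator `x` sends each vector of the string through the vector `v` killed
by `x` to a multiple of the previous one. -/
theorem LieAlgebra.exists_lie_ad_pow_succ_eq_smul {x y v : L} {a b : R}
    (hy : ⁅⁅x, y⁆, y⁆ = a • y) (hv : ⁅⁅x, y⁆, v⁆ = b • v) (hxv : ⁅x, v⁆ = 0) (n : ℕ) :
    ∃ c : R, ⁅x, (LieAlgebra.ad R L y ^ (n + 1)) v⁆ = c • (LieAlgebra.ad R L y ^ n) v := by
  induction n with
  | zero =>
    refine ⟨b, ?_⟩
    rw [ad_pow_succ_apply, pow_zero, Module.End.one_apply, leibniz_lie, hv, hxv, lie_zero, add_zero]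
  | succ n ih =>
    obtain ⟨c, hc⟩ := ih
    obtain ⟨d, hd⟩ := exists_lie_ad_pow_eq_smul hy hv (n + 1)
    refine ⟨d + c, ?_⟩
    rw [ad_pow_succ_apply, leibniz_lie, hd, hc, lie_smul, ← ad_pow_succ_apply (R := R), add_smul]

/-- If `u` commutes with `y` and `v`, and `v` is killed by `x` and a weight vector for `⁅x, y⁆`,
then the `x`-string through `u` commutes with the `y`-string through `v`. -/
theorem LieAlgebra.lie_ad_pow_ad_pow_eq_zero {x y u v : L} {a b : R}
    (hy : ⁅⁅x, y⁆, y⁆ = a • y) (hv : ⁅⁅x, y⁆, v⁆ = b • v)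
    (hxv : ⁅x, v⁆ = 0) (huy : ⁅u, y⁆ = 0) (huv : ⁅u, v⁆ = 0) (k n : ℕ) :
    ⁅(LieAlgebra.ad R L x ^ k) u, (LieAlgebra.ad R L y ^ n) v⁆ = 0 := by
  induction k generalizing n with
  | zero => simpa using lie_ad_pow_eq_zero huy huv n
  | succ k ih =>
    rw [ad_pow_succ_apply, lie_lie, ih, lie_zero, zero_sub, neg_eq_zero]
    cases n with
    | zero => rw [pow_zero, Module.End.one_apply, hxv, lie_zero]
    | succ n =>
      obtain ⟨c, hc⟩ := exists_lie_ad_pow_succ_eq_smul hy hv hxv n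
      rw [hc, lie_smul, ih, smul_zero]

end IteratedBracket

theorem monster_L1_distinct_block {L : Type*} [LieRing L] [LieAlgebra ℂ L]
    (j : ℕ) (hj : 1 ≤ j)
    (eneg fneg h₁ h₂ e f : L)
    (rel_hh : ⁅h₁, h₂⁆ = 0)
    (rel_h1eneg : ⁅h₁, eneg⁆ = eneg) (rel_h2eneg : ⁅h₂, eneg⁆ = -eneg)
    (rel_h1fneg : ⁅h₁, fneg⁆ = -fneg) (rel_h2fneg : ⁅h₂, fneg⁆ = fneg)
    (rel_h1e : ⁅h₁, e⁆ = e) (rel_h2e : ⁅h₂, e⁆ = (j : ℂ) • e)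
    (rel_h1f : ⁅h₁, f⁆ = -f) (rel_h2f : ⁅h₂, f⁆ = -((j : ℂ) • f))
    (rel_enegfneg : ⁅eneg, fneg⁆ = h₁ - h₂)
    (rel_enegf : ⁅eneg, f⁆ = 0) (rel_efneg : ⁅e, fneg⁆ = 0)
    (rel_ef : ⁅e, f⁆ = -((j : ℂ) • h₁ + h₂))
    (rel_serre_e : (LieAlgebra.ad ℂ L eneg ^ j) e = 0)
    (rel_serre_f : (LieAlgebra.ad ℂ L fneg ^ j) f = 0)
    (eV fV : ℕ → L)
    (heV : ∀ ℓ : ℕ, eV ℓ = ((ℓ.factorial : ℂ))⁻¹ • (LieAlgebra.ad ℂ L eneg ^ ℓ) e)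
    (hfV : ∀ ℓ : ℕ, fV ℓ = ((ℓ.factorial : ℂ))⁻¹ • (LieAlgebra.ad ℂ L fneg ^ ℓ) f)
    (p : ℕ) (hp : 1 ≤ p) (e' f' : L)
    (rel_h1e' : ⁅h₁, e'⁆ = e') (rel_h2e' : ⁅h₂, e'⁆ = (p : ℂ) • e')
    (rel_h1f' : ⁅h₁, f'⁆ = -f') (rel_h2f' : ⁅h₂, f'⁆ = -((p : ℂ) • f'))
    (rel_enegf' : ⁅eneg, f'⁆ = 0) (rel_e'fneg : ⁅e', fneg⁆ = 0)
    (rel_ef' : ⁅e, f'⁆ = 0) (rel_e'f : ⁅e', f⁆ = 0)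
    (rel_serre_e' : (LieAlgebra.ad ℂ L eneg ^ p) e' = 0)
    (rel_serre_f' : (LieAlgebra.ad ℂ L fneg ^ p) f' = 0)
    (fV' : ℕ → L)
    (hfV' : ∀ m : ℕ, fV' m = ((m.factorial : ℂ))⁻¹ • (LieAlgebra.ad ℂ L fneg ^ m) f') :
    ∀ ℓ m : ℕ, ℓ ≤ j - 1 → m ≤ p - 1 → ⁅eV ℓ, fV' m⁆ = 0 := by
  intro ℓ m _ _
  have hy : ⁅⁅eneg, fneg⁆, fneg⁆ = (-2 : ℂ) • fneg := by
    rw [rel_enegfneg, sub_lie, rel_h1fneg, rel_h2fneg]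
    module
  have hv : ⁅⁅eneg, fneg⁆, f'⁆ = ((p : ℂ) - 1) • f' := by
    rw [rel_enegfneg, sub_lie, rel_h1f', rel_h2f']
    module
  rw [heV, hfV', smul_lie, lie_smul,
    LieAlgebra.lie_ad_pow_ad_pow_eq_zero hy hv rel_enegf' rel_efneg rel_ef',
    smul_zero, smul_zero]
end

section
/- Fix ℓ with 0 ≤ ℓ ≤ j-1 and set c := (-1)^{ℓ+1} • C(j-1,ℓ) • (ℓ+1) • (j-ℓ) ∈ ℂ (which is nonzero). Then the elements ē := e_ℓ, f̄ := (1/c)•f_ℓ, h̄₁ := (1/(ℓ+1))•h₁, h̄₂ := (-1/(j-ℓ))•h₂ form a standard basis of a 𝔤𝔩₂ subalgebra, i.e. they satisfy ⁅h̄₁,h̄₂⁆ = 0, ⁅h̄₁,ē⁆ = ē, ⁅h̄₂,ē⁆ = -ē, ⁅h̄₁,f̄⁆ = -f̄, ⁅h̄₂,f̄⁆ = f̄, and ⁅ē,f̄⁆ = h̄₁ - h̄₂. (The proposition of Subsection 4.3 of the paper, giving the standard basis of 𝔤𝔩₂(ℓ,j,k).) -/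
section Helpers

open LieAlgebra

variable {R L : Type*} [CommRing R] [LieRing L] [LieAlgebra R L]

lemma lie_ad_pow_of_weight {h x v : L} {a b : R} (hx : ⁅h, x⁆ = a • x) (hv : ⁅h, v⁆ = b • v)
    (m : ℕ) : ⁅h, (ad R L x ^ m) v⁆ = (b + m * a) • (ad R L x ^ m) v := by
  induction m with
  | zero => simp [hv]
  | succ m ih =>
    rw [pow_succ', Module.End.mul_apply, ad_apply, leibniz_lie, hx, ih, smul_lie, lie_smul,
      ← add_smul]
    congr 1
    push_cast
    ring

/-- Raising a vector of the string through a primitive vector `v` of `sl₂`-weight `k`. -/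
lemma lie_ad_pow_succ_of_primitive {x y v : L} {k : R} (hx : ⁅x, v⁆ = 0)
    (hy : ⁅⁅x, y⁆, y⁆ = (-2 : R) • y) (hv : ⁅⁅x, y⁆, v⁆ = k • v) (m : ℕ) :
    ⁅x, (ad R L y ^ (m + 1)) v⁆ = (((m : R) + 1) * (k - m)) • (ad R L y ^ m) v := by
  induction m with
  | zero => simp [leibniz_lie x, hx, hv]
  | succ m ih =>
    rw [pow_succ', Module.End.mul_apply, ad_apply, leibniz_lie, ih,
      lie_ad_pow_of_weight hy hv, lie_smul, ← ad_apply R L y, ← Module.End.mul_apply,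
      ← pow_succ', ← add_smul]
    congr 1
    push_cast
    ring

lemma lie_ad_pow_of_commute {x y v : L} (hx : ⁅x, y⁆ = 0) (m : ℕ) :
    ⁅x, (ad R L y ^ m) v⁆ = (ad R L y ^ m) ⁅x, v⁆ := by
  induction m with
  | zero => simp
  | succ m ih =>
    rw [pow_succ', Module.End.mul_apply, Module.End.mul_apply, ad_apply, leibniz_lie, hx, ih,
      zero_lie, zero_add, ad_apply]

lemma lie_ad_pow_ad_pow {x y h₁ h₂ e f : L} {z : R}
    (h1y : ⁅h₁, y⁆ = -y) (h2y : ⁅h₂, y⁆ = y)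
    (h1f : ⁅h₁, f⁆ = -f) (h2f : ⁅h₂, f⁆ = -(z • f))
    (hxy : ⁅x, y⁆ = h₁ - h₂) (hxf : ⁅x, f⁆ = 0) (hey : ⁅e, y⁆ = 0)
    (hef : ⁅e, f⁆ = -(z • h₁ + h₂)) (m : ℕ) :
    (∀ n, ⁅(ad R L x ^ m) e, (ad R L y ^ (m + 2 + n)) f⁆ = 0) ∧
    ⁅(ad R L x ^ m) e, (ad R L y ^ (m + 1)) f⁆ =
      (∏ i ∈ Finset.range (m + 1), -(((i : R) + 1) * (z - 1 - i))) • y ∧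
    ⁅(ad R L x ^ m) e, (ad R L y ^ m) f⁆ =
      (-∏ i ∈ Finset.range m, -(((i : R) + 1) * (z - 1 - i))) •
        ((z - m) • h₁ + ((m : R) + 1) • h₂) := by
  have hyy : ⁅⁅x, y⁆, y⁆ = (-2 : R) • y := by
    rw [hxy, sub_lie, h1y, h2y]
    module
  have hff : ⁅⁅x, y⁆, f⁆ = (z - 1) • f := by
    rw [hxy, sub_lie, h1f, h2f]
    module
  have lower := lie_ad_pow_succ_of_primitive hxf hyy hff
  have step (m n : ℕ) : ⁅(ad R L x ^ (m + 1)) e, (ad R L y ^ (n + 1)) f⁆ =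
      ⁅x, ⁅(ad R L x ^ m) e, (ad R L y ^ (n + 1)) f⁆⁆ -
        (((n : R) + 1) * (z - 1 - n)) • ⁅(ad R L x ^ m) e, (ad R L y ^ n) f⁆ := by
    rw [pow_succ', Module.End.mul_apply, ad_apply, lie_lie, lower, lie_smul]
  induction m with
  | zero =>
    have first : ⁅y, ⁅e, f⁆⁆ = (1 - z) • y := by
      rw [hef, lie_neg, lie_add, lie_smul, ← lie_skew y h₁, ← lie_skew y h₂, h1y, h2y]
      module
    refine ⟨fun n => ?_, ?_, ?_⟩
    · rw [pow_zero, Module.End.one_apply, lie_ad_pow_of_commute hey,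
        show 0 + 2 + n = n + 1 + 1 by ring, pow_succ, pow_succ, Module.End.mul_apply,
        Module.End.mul_apply, ad_apply, ad_apply, first, lie_smul, lie_self, smul_zero, map_zero]
    · rw [pow_zero, Module.End.one_apply, lie_ad_pow_of_commute hey, zero_add, pow_one, ad_apply,
        first]
      simp
    · simp [hef, add_comm]
  | succ m ih =>
    obtain ⟨hzero, hsucc, hdiag⟩ := ih
    refine ⟨fun n => ?_, ?_, ?_⟩
    · have h₀ := hzero (n + 1)
      have h₁ := hzero n
      rw [← add_assoc] at h₀
      rw [show m + 1 + 2 + n = m + 2 + n + 1 by ring, step, h₀, h₁, lie_zero, smul_zero, sub_zero]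
    · have h₀ := hzero 0
      rw [add_zero] at h₀
      rw [step, h₀, hsucc, Finset.prod_range_succ _ (m + 1), lie_zero, zero_sub, smul_smul,
        ← neg_smul]
      congr 1
      ring
    · rw [step, hsucc, hdiag, Finset.prod_range_succ, lie_smul, hxy]
      push_cast
      module

end Helpers

lemma prod_range_neg_succ_mul_sub (k m : ℕ) (hm : m ≤ k) :
    ∏ i ∈ Finset.range m, -(((i : ℂ) + 1) * (k - i)) =
      (-1) ^ m * (m.factorial : ℂ) ^ 2 * (k.choose m : ℂ) := by
  induction m with
  | zero => simp
  | succ m ih =>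
    have h : (k.choose (m + 1) : ℂ) * (m + 1) = k.choose m * (k - m) := by
      rw [← Nat.cast_sub (Nat.le_of_succ_le hm)]
      exact_mod_cast Nat.choose_succ_right_eq k m
    rw [Finset.prod_range_succ, ih (Nat.le_of_succ_le hm), Nat.factorial_succ]
    push_cast
    linear_combination (-1) ^ m * (m.factorial : ℂ) ^ 2 * ((m : ℂ) + 1) * h


theorem monster_gl2_standard_basis {L : Type*} [LieRing L] [LieAlgebra ℂ L]
    (j : ℕ) (hj : 1 ≤ j)
    (eneg fneg h₁ h₂ e f : L)
    (rel_hh : ⁅h₁, h₂⁆ = 0)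
    (rel_h1eneg : ⁅h₁, eneg⁆ = eneg) (rel_h2eneg : ⁅h₂, eneg⁆ = -eneg)
    (rel_h1fneg : ⁅h₁, fneg⁆ = -fneg) (rel_h2fneg : ⁅h₂, fneg⁆ = fneg)
    (rel_h1e : ⁅h₁, e⁆ = e) (rel_h2e : ⁅h₂, e⁆ = (j : ℂ) • e)
    (rel_h1f : ⁅h₁, f⁆ = -f) (rel_h2f : ⁅h₂, f⁆ = -((j : ℂ) • f))
    (rel_enegfneg : ⁅eneg, fneg⁆ = h₁ - h₂)
    (rel_enegf : ⁅eneg, f⁆ = 0) (rel_efneg : ⁅e, fneg⁆ = 0)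
    (rel_ef : ⁅e, f⁆ = -((j : ℂ) • h₁ + h₂))
    (rel_serre_e : (LieAlgebra.ad ℂ L eneg ^ j) e = 0)
    (rel_serre_f : (LieAlgebra.ad ℂ L fneg ^ j) f = 0)
    (eV fV : ℕ → L)
    (heV : ∀ ℓ : ℕ, eV ℓ = ((ℓ.factorial : ℂ))⁻¹ • (LieAlgebra.ad ℂ L eneg ^ ℓ) e)
    (hfV : ∀ ℓ : ℕ, fV ℓ = ((ℓ.factorial : ℂ))⁻¹ • (LieAlgebra.ad ℂ L fneg ^ ℓ) f)
    (ℓ : ℕ) (hℓ : ℓ ≤ j - 1)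
    (c : ℂ) (hc : c = (-1 : ℂ) ^ (ℓ + 1) * ((j - 1).choose ℓ : ℂ) * ((ℓ : ℂ) + 1) * ((j : ℂ) - (ℓ : ℂ)))
    (ebar fbar hbar₁ hbar₂ : L)
    (hebar : ebar = eV ℓ) (hfbar : fbar = c⁻¹ • fV ℓ)
    (hhbar₁ : hbar₁ = ((ℓ : ℂ) + 1)⁻¹ • h₁)
    (hhbar₂ : hbar₂ = (-((j : ℂ) - (ℓ : ℂ))⁻¹) • h₂) :
    c ≠ 0 ∧
    ⁅hbar₁, hbar₂⁆ = 0 ∧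
    ⁅hbar₁, ebar⁆ = ebar ∧ ⁅hbar₂, ebar⁆ = -ebar ∧
    ⁅hbar₁, fbar⁆ = -fbar ∧ ⁅hbar₂, fbar⁆ = fbar ∧
    ⁅ebar, fbar⁆ = hbar₁ - hbar₂ := by
  have hsub : (j : ℂ) - 1 = ((j - 1 : ℕ) : ℂ) := by push_cast [hj]; rfl
  have hl : (ℓ : ℂ) + 1 ≠ 0 := by exact_mod_cast ℓ.succ_ne_zero
  have hjl : (j : ℂ) - ℓ ≠ 0 := sub_ne_zero.mpr (by exact_mod_cast (by omega : j ≠ ℓ))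
  have hfac : (ℓ.factorial : ℂ) ≠ 0 := by exact_mod_cast ℓ.factorial_ne_zero
  have hch : ((j - 1).choose ℓ : ℂ) ≠ 0 := by exact_mod_cast (Nat.choose_pos hℓ).ne'
  have hsign : (-1 : ℂ) ^ (ℓ + 1) ≠ 0 := pow_ne_zero _ (by norm_num)
  have hc0 : c ≠ 0 := by
    rw [hc]
    exact mul_ne_zero (mul_ne_zero (mul_ne_zero hsign hch) hl) hjl
  have w1e := lie_ad_pow_of_weight (R := ℂ) (a := 1) (b := 1) (h := h₁) (x := eneg) (v := e)
    (by simpa) (by simpa) ℓ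
  have w2e := lie_ad_pow_of_weight (R := ℂ) (a := -1) (h := h₂) (x := eneg)
    (by simpa) rel_h2e ℓ
  have w1f := lie_ad_pow_of_weight (R := ℂ) (a := -1) (b := -1) (h := h₁) (x := fneg) (v := f)
    (by simpa) (by simpa) ℓ
  have w2f := lie_ad_pow_of_weight (R := ℂ) (a := 1) (b := -j) (h := h₂) (x := fneg) (v := f)
    (by simpa) (by simpa) ℓ
  have hef := (lie_ad_pow_ad_pow rel_h1fneg rel_h2fneg rel_h1f rel_h2f rel_enegfneg rel_enegf
    rel_efneg rel_ef ℓ).2.2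
  rw [hsub, prod_range_neg_succ_mul_sub _ _ hℓ] at hef
  subst ebar fbar hbar₁ hbar₂
  rw [heV, hfV]
  refine ⟨hc0, ?_, ?_, ?_, ?_, ?_, ?_⟩
  · simp [rel_hh]
  · rw [smul_lie, lie_smul, w1e]
    match_scalars
    field_simp
    ring
  · rw [smul_lie, lie_smul, w2e]
    match_scalars
    field_simp
    ring
  · rw [smul_lie, lie_smul, lie_smul, w1f]
    match_scalars
    field_simp
    ring
  · rw [smul_lie, lie_smul, lie_smul, w2f]
    match_scalars
    field_simp
    ring
  · rw [smul_lie, lie_smul, lie_smul, hef]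
    match_scalars <;> rw [hc] <;> field_simp <;> ring
end
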